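/- All well behaved equilibria of the Length Game are utilitarian equivalent: if (S_1,...,S_n) and (S'_1,...,S'_n) are two well behaved profiles in equilibrium with resulting allocations (A_1,...,A_n) and (A'_1,...,A'_n) respectively, then u_i(A_i) = u_i(A'_i) for every agent i. -/

import Mathlib

open MeasureTheory

/-- A piecewise uniform preference set: a finite union of closed intervals inside `[0,1]`
with positive total length. -/
def PWUniform (P : Set ℝ) : Prop :=
  (∃ (m : ℕ) (a b : Fin m → ℝ), P = ⋃ k, Set.Icc (a k) (b k)) ∧
    P ⊆ Set.Icc 0 1 ∧ 0 < volume P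

/-- Piecewise uniform utility: `u_P(X) = |X ∩ P| / |P|`. -/
noncomputable def pwUtil (P X : Set ℝ) : ℝ :=
  (volume (X ∩ P)).toReal / (volume P).toReal

/-- The Length Game precedence order: `i ≺ j` iff `|S i| < |S j|`, or `|S i| = |S j|`
and `i < j`. -/
def lgPrec {n : ℕ} (S : Fin n → Set ℝ) (i j : Fin n) : Prop :=
  volume (S i) < volume (S j) ∨ (volume (S i) = volume (S j) ∧ i < j)

/-- The Length Game allocation: `A i = S i \ ⋃_{j ≺ i} S j`. -/
def lgAlloc {n : ℕ} (S : Fin n → Set ℝ) (i : Fin n) : Set ℝ :=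
  S i \ ⋃ (j) (_ : lgPrec S j i), S j

/-- A valid Length Game strategy: a measurable subset of the cake `[0,1]`. -/
def IsStrategy (S : Set ℝ) : Prop :=
  MeasurableSet S ∧ S ⊆ Set.Icc 0 1

/-- A profile is in equilibrium if no agent can strictly increase their utility by
unilaterally switching to another strategy. -/
def lgEquilibrium {n : ℕ} (P S : Fin n → Set ℝ) : Prop :=
  ¬ ∃ (i : Fin n) (S' : Set ℝ), IsStrategy S' ∧
    pwUtil (P i) (lgAlloc S i) < pwUtil (P i) (lgAlloc (Function.update S i S') i)

open Set Filter Topology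

/-- A set of positive Lebesgue measure has subsets of arbitrarily small positive measure. -/
theorem exists_measurable_subset_volume_lt {T : Set ℝ} (hT : MeasurableSet T)
    (hpos : volume T ≠ 0) {ε : ENNReal} (hε : 0 < ε) :
    ∃ U ⊆ T, MeasurableSet U ∧ 0 < volume U ∧ volume U < ε := by
  obtain ⟨x, -, hx⟩ := exists_mem_forall_mem_nhdsWithin_pos_measure hpos
  have hlim : Tendsto (fun δ : ℝ ↦ ENNReal.ofReal (2 * δ)) (𝓝[>] 0) (𝓝 0) := by
    have : Continuous fun δ : ℝ ↦ ENNReal.ofReal (2 * δ) :=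
      ENNReal.continuous_ofReal.comp (by fun_prop)
    simpa using (this.tendsto 0).mono_left nhdsWithin_le_nhds
  obtain ⟨δ, hδε, hδ⟩ := ((hlim.eventually_lt_const hε).and self_mem_nhdsWithin).exists
  refine ⟨T ∩ Metric.ball x δ, inter_subset_left, hT.inter measurableSet_ball,
    hx _ (inter_mem_nhdsWithin _ (Metric.ball_mem_nhds x hδ)), ?_⟩
  calc volume (T ∩ Metric.ball x δ) ≤ volume (Metric.ball x δ) := measure_mono inter_subset_right
    _ = ENNReal.ofReal (2 * δ) := Real.volume_ball x δ
    _ < ε := hδε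

section Allocation

variable {ι α : Type*} [Fintype ι] [MeasurableSpace α] {μ : Measure α} [IsFiniteMeasure μ]

/-- If the pieces `A j` with `μ (A j) ≤ μ (A i)` cover the demands of their owners, then no
allocation which is at least as good as `A` for all these owners is better for agent `i`. -/
theorem measureReal_le_of_cover {P A A' : ι → Set α}
    (hA : ∀ i, MeasurableSet (A i)) (hA' : ∀ i, MeasurableSet (A' i))
    (hd : Pairwise (Function.onFun Disjoint A)) (hd' : Pairwise (Function.onFun Disjoint A'))
    (hsub' : ∀ i, A' i ⊆ P i)
    (hcov : ∀ i, μ (P i \ ⋃ (j) (_ : μ.real (A j) ≤ μ.real (A i)), A j) = 0)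
    (i : ι) (hle : ∀ j, μ.real (A j) ≤ μ.real (A i) → μ.real (A j) ≤ μ.real (A' j)) :
    μ.real (A' i) ≤ μ.real (A i) := by
  classical
  set N : Finset ι := {j | μ.real (A j) ≤ μ.real (A i)} with hN
  have hsum : ∑ j ∈ N, μ.real (A' j) ≤ ∑ j ∈ N, μ.real (A j) := by
    rw [← measureReal_biUnion_finset (fun _ _ _ _ h ↦ hd' h) (fun j _ ↦ hA' j),
      ← measureReal_biUnion_finset (fun _ _ _ _ h ↦ hd h) (fun j _ ↦ hA j)]
    refine ENNReal.toReal_mono (measure_ne_top _ _) (measure_mono_ae ?_)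
    rw [ae_le_set]
    simp only [iUnion_sdiff]
    refine (measure_biUnion_null_iff N.countable_toSet).2 fun j hj ↦ ?_
    refine measure_mono_null (sdiff_subset_sdiff (hsub' j) ?_) (hcov j)
    refine iUnion₂_subset fun k hk ↦ subset_biUnion_of_mem (u := A) (Finset.mem_coe.2 ?_)
    simp only [hN, Finset.mem_coe, Finset.mem_filter, Finset.mem_univ, true_and] at hj ⊢
    exact hk.trans hj
  by_contra! hlt
  exact hsum.not_gt (Finset.sum_lt_sum (fun j hj ↦ hle j (by simpa [hN] using hj))
    ⟨i, by simp [hN], hlt⟩)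

/-- Two allocations in which each agent's demand is covered by pieces no larger than the agent's
own give every agent pieces of the same size. -/
theorem measureReal_eq_of_cover {P A A' : ι → Set α}
    (hA : ∀ i, MeasurableSet (A i)) (hA' : ∀ i, MeasurableSet (A' i))
    (hd : Pairwise (Function.onFun Disjoint A)) (hd' : Pairwise (Function.onFun Disjoint A'))
    (hsub : ∀ i, A i ⊆ P i) (hsub' : ∀ i, A' i ⊆ P i)
    (hcov : ∀ i, μ (P i \ ⋃ (j) (_ : μ.real (A j) ≤ μ.real (A i)), A j) = 0)
    (hcov' : ∀ i, μ (P i \ ⋃ (j) (_ : μ.real (A' j) ≤ μ.real (A' i)), A' j) = 0) (i : ι) :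
    μ.real (A i) = μ.real (A' i) := by
  classical
  by_contra hne
  obtain ⟨k, hk, hmin⟩ := Finset.exists_min_image
    ({j | μ.real (A j) ≠ μ.real (A' j)} : Finset ι)
    (fun j ↦ min (μ.real (A j)) (μ.real (A' j))) ⟨i, by simpa using hne⟩
  simp only [Finset.mem_filter, Finset.mem_univ, true_and] at hk hmin
  have key : ∀ j, μ.real (A j) ≠ μ.real (A' j) →
      min (μ.real (A k)) (μ.real (A' k)) ≤ μ.real (A j) ∧
        min (μ.real (A k)) (μ.real (A' k)) ≤ μ.real (A' j) :=
    fun j hj ↦ le_min_iff.1 (hmin j hj)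
  rcases hk.lt_or_gt with hlt | hlt
  · refine hlt.not_ge (measureReal_le_of_cover hA hA' hd hd' hsub' hcov k fun j hj ↦ ?_)
    by_cases hj' : μ.real (A j) = μ.real (A' j)
    · exact hj'.le
    · exact hj.trans (by simpa [hlt.le] using (key j hj').2)
  · refine hlt.not_ge (measureReal_le_of_cover hA' hA hd' hd hsub hcov' k fun j hj ↦ ?_)
    by_cases hj' : μ.real (A j) = μ.real (A' j)
    · exact hj'.ge
    · exact hj.trans (by simpa [hlt.le] using (key j hj').1)

end Allocation

section LengthGame

variable {n : ℕ} {P S : Fin n → Set ℝ}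

theorem lgPrec.volume_le {i j : Fin n} (h : lgPrec S i j) : volume (S i) ≤ volume (S j) :=
  h.elim le_of_lt fun h ↦ h.1.le

theorem lgPrec.ne {i j : Fin n} (h : lgPrec S i j) : i ≠ j := by
  rintro rfl
  exact h.elim (lt_irrefl _) fun h ↦ lt_irrefl _ h.2

theorem lgPrec_or_lgPrec {i j : Fin n} (h : i ≠ j) : lgPrec S i j ∨ lgPrec S j i := by
  unfold lgPrec
  rcases lt_trichotomy (volume (S i)) (volume (S j)) with h' | h' | h'
  · exact .inl (.inl h')
  · exact h.lt_or_gt.imp (fun h ↦ .inr ⟨h', h⟩) fun h ↦ .inr ⟨h'.symm, h⟩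
  · exact .inr (.inl h')

theorem lgAlloc_subset (i : Fin n) : lgAlloc S i ⊆ S i := sdiff_subset

theorem disjoint_lgAlloc_of_lgPrec {i j : Fin n} (h : lgPrec S i j) :
    Disjoint (S i) (lgAlloc S j) :=
  disjoint_sdiff_right.mono_left (subset_iUnion₂ (s := fun k (_ : lgPrec S k j) ↦ S k) i h)

theorem pairwise_disjoint_lgAlloc : Pairwise (Function.onFun Disjoint (lgAlloc S)) := by
  intro i j h
  rcases lgPrec_or_lgPrec h with h | h
  · exact (disjoint_lgAlloc_of_lgPrec h).mono_left (lgAlloc_subset i)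
  · exact ((disjoint_lgAlloc_of_lgPrec h).mono_left (lgAlloc_subset j)).symm

theorem measurableSet_lgAlloc (hS : ∀ i, MeasurableSet (S i)) (i : Fin n) :
    MeasurableSet (lgAlloc S i) :=
  (hS i).diff (.iUnion fun j ↦ .iUnion fun _ ↦ hS j)

/-- Every point of some strategy `S j` is allocated to an agent whose strategy is no longer. -/
theorem exists_mem_lgAlloc {j : Fin n} {x : ℝ} (hx : x ∈ S j) :
    ∃ k, volume (S k) ≤ volume (S j) ∧ x ∈ lgAlloc S k := by
  classical
  obtain ⟨k, hk, hmin⟩ := Finset.exists_min_image ({k | x ∈ S k} : Finset (Fin n))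
    (fun k ↦ toLex (volume (S k), k)) ⟨j, by simpa using hx⟩
  simp only [Finset.mem_filter, Finset.mem_univ, true_and, Prod.Lex.toLex_le_toLex] at hk hmin
  refine ⟨k, (hmin j hx).elim le_of_lt fun h ↦ h.1.le, hk, ?_⟩
  simp only [mem_iUnion, not_exists]
  intro l hl hxl
  rcases hmin l hxl, hl with ⟨h | h, h' | h'⟩
  · exact lt_asymm h h'
  · exact h.ne h'.1.symm
  · exact h'.ne h.1.symm
  · exact h.2.not_gt h'.2

/-- In equilibrium, an agent cannot enlarge their piece by a part `T` of their demand when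
neither `T` nor the piece meets the strategies no longer than the piece. -/
theorem lgEquilibrium.volume_eq_zero (heq : lgEquilibrium P S)
    (hP : ∀ i, P i ⊆ Icc 0 1) (hS : ∀ i, MeasurableSet (S i)) (hwb : ∀ i, S i ⊆ P i)
    {j : Fin n} {T : Set ℝ} (hT : MeasurableSet T) (hTP : T ⊆ P j)
    (hTA : Disjoint (lgAlloc S j) T)
    (hfree : ∀ k, k ≠ j → volume (S k) ≤ volume (lgAlloc S j) →
      volume (S k ∩ (lgAlloc S j ∪ T)) = 0) :
    volume T = 0 := by
  by_contra hpos
  set a := volume (lgAlloc S j) with ha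
  have hfin : ∀ {X}, X ⊆ P j → volume X ≠ ⊤ := fun h ↦
    ((measure_mono (h.trans (hP j))).trans_lt (by simp)).ne
  have hAP : lgAlloc S j ⊆ P j := (lgAlloc_subset j).trans (hwb j)
  obtain ⟨ε, hε, hε0⟩ : ∃ ε : ENNReal, (∀ k, a < volume (S k) → a + ε < volume (S k)) ∧ 0 < ε := by
    have hlim : Tendsto (fun ε : ENNReal ↦ a + ε) (𝓝[>] 0) (𝓝 a) := by
      have : Continuous fun ε : ENNReal ↦ a + ε := by fun_prop
      simpa using (this.tendsto 0).mono_left nhdsWithin_le_nhds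
    have hev : ∀ᶠ ε in 𝓝[>] (0 : ENNReal), ∀ k, a < volume (S k) → a + ε < volume (S k) :=
      eventually_all.2 fun k ↦ by
        by_cases hk : a < volume (S k)
        · exact (hlim.eventually_lt_const hk).mono fun _ h _ ↦ h
        · exact .of_forall fun _ h ↦ absurd h hk
    exact (hev.and self_mem_nhdsWithin).exists
  obtain ⟨U, hUT, hU, hU0, hUε⟩ := exists_measurable_subset_volume_lt hT hpos hε0
  have hXP : lgAlloc S j ∪ U ⊆ P j := union_subset hAP (hUT.trans hTP)
  have hX : volume (lgAlloc S j ∪ U) = a + volume U :=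
    measure_union (hTA.mono_right hUT) hU
  refine heq ⟨j, lgAlloc S j ∪ U, ⟨(measurableSet_lgAlloc hS j).union hU, hXP.trans (hP j)⟩, ?_⟩
  set X := lgAlloc S j ∪ U
  set A' := lgAlloc (Function.update S j X) j with hA'
  have hA'X : A' ⊆ X := by simpa using lgAlloc_subset (S := Function.update S j X) j
  have hXA' : volume (X \ A') = 0 := by
    have : X \ A' ⊆ ⋃ (k) (_ : k ≠ j ∧ volume (S k) ≤ a), S k ∩ (lgAlloc S j ∪ T) := by
      rintro x ⟨hxX, hxA'⟩
      simp only [hA', lgAlloc, Function.update_self, Set.mem_sdiff, hxX, true_and, not_not,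
        mem_iUnion] at hxA'
      obtain ⟨k, hkj, hxk⟩ := hxA'
      have hk := hkj.ne
      have hle := hkj.volume_le
      rw [Function.update_of_ne hk] at hxk hle
      rw [Function.update_self, hX] at hle
      simp only [mem_iUnion]
      refine ⟨k, ⟨hk, ?_⟩, hxk, union_subset_union_right _ hUT hxX⟩
      by_contra! hlt
      exact ((hε k hlt).trans_le hle).not_ge (by gcongr)
    refine measure_mono_null this ?_
    simp only [measure_iUnion_null_iff]
    exact fun k hk ↦ hfree k hk.1 hk.2
  have hvol : volume A' = a + volume U := by
    rw [← hX]
    refine le_antisymm (measure_mono hA'X) (measure_mono_ae ?_)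
    rwa [ae_le_set]
  have hpos' : 0 < (volume (P j)).toReal :=
    ENNReal.toReal_pos (hU0.trans_le (measure_mono (hUT.trans hTP))).ne' (hfin Subset.rfl)
  unfold pwUtil
  rw [inter_eq_left.2 hAP, inter_eq_left.2 (hA'X.trans hXP), hvol]
  gcongr
  · exact ENNReal.add_ne_top.2 ⟨hfin hAP, hfin (hUT.trans hTP)⟩
  · exact ENNReal.lt_add_right (hfin hAP) hU0.ne'

/-- In a well behaved equilibrium, the piece of an agent meets no other strategy of the length of
that piece or less. -/
theorem lgEquilibrium.volume_inter_lgAlloc (heq : lgEquilibrium P S)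
    (hP : ∀ i, P i ⊆ Icc 0 1) (hS : ∀ i, MeasurableSet (S i)) (hwb : ∀ i, S i ⊆ P i)
    {j k : Fin n} (hkj : k ≠ j) (hle : volume (S k) ≤ volume (lgAlloc S j)) :
    volume (S k ∩ lgAlloc S j) = 0 := by
  rcases lgPrec_or_lgPrec (S := S) hkj with h | h
  · rw [(disjoint_lgAlloc_of_lgPrec h).inter_eq, measure_empty]
  by_contra hpos
  have hkA : Disjoint (lgAlloc S k) (S k ∩ lgAlloc S j) :=
    (disjoint_lgAlloc_of_lgPrec h).symm.mono_right (inter_subset_right.trans (lgAlloc_subset j))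
  have hT : MeasurableSet (S k ∩ lgAlloc S j) := (hS k).inter (measurableSet_lgAlloc hS j)
  have hlt : volume (lgAlloc S k) < volume (S k) := by
    have hfin : volume (lgAlloc S k) ≠ ⊤ :=
      ((measure_mono ((lgAlloc_subset k).trans ((hwb k).trans (hP k)))).trans_lt (by simp)).ne
    refine (ENNReal.lt_add_right hfin hpos).trans_le ?_
    rw [← measure_union hkA hT]
    exact measure_mono (union_subset (lgAlloc_subset k) inter_subset_left)
  refine hpos (heq.volume_eq_zero hP hS hwb hT (inter_subset_left.trans (hwb k)) hkA ?_)
  intro l _ hl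
  have hlk := hl.trans_lt hlt
  have hlj : volume (S l) < volume (S j) :=
    hlk.trans_le (hle.trans (measure_mono (lgAlloc_subset j)))
  have h₁ := disjoint_lgAlloc_of_lgPrec (S := S) (.inl hlk)
  have h₂ := disjoint_lgAlloc_of_lgPrec (S := S) (.inl hlj)
  rw [(h₁.union_right (h₂.mono_right inter_subset_right)).inter_eq, measure_empty]

/-- In a well behaved equilibrium, the demand of each agent is covered by pieces no larger than
the agent's own piece. -/
theorem lgEquilibrium.volume_diff_iUnion_lgAlloc (heq : lgEquilibrium P S)
    (hP : ∀ i, P i ⊆ Icc 0 1) (hPm : ∀ i, MeasurableSet (P i)) (hS : ∀ i, MeasurableSet (S i))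
    (hwb : ∀ i, S i ⊆ P i) (j : Fin n) :
    volume (P j \ ⋃ (k) (_ : volume (lgAlloc S k) ≤ volume (lgAlloc S j)), lgAlloc S k) = 0 := by
  set a := volume (lgAlloc S j)
  set W := ⋃ (k) (_ : volume (S k) ≤ a), S k with hW
  have hWm : MeasurableSet W := .iUnion fun k ↦ .iUnion fun _ ↦ hS k
  have hnull : volume (P j \ (W ∪ lgAlloc S j)) = 0 := by
    refine heq.volume_eq_zero hP hS hwb ((hPm j).diff (hWm.union (measurableSet_lgAlloc hS j)))
      sdiff_subset (disjoint_sdiff_right.mono_left subset_union_right) fun k hk hle ↦ ?_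
    have hd : Disjoint (S k) (P j \ (W ∪ lgAlloc S j)) :=
      disjoint_sdiff_right.mono_left
        ((subset_iUnion₂ (s := fun k (_ : volume (S k) ≤ a) ↦ S k) k hle).trans subset_union_left)
    rw [inter_union_distrib_left, hd.inter_eq, union_empty]
    exact heq.volume_inter_lgAlloc hP hS hwb hk hle
  refine measure_mono_null (sdiff_subset_sdiff_right (union_subset ?_ ?_)) hnull
  · refine iUnion₂_subset fun k hk x hx ↦ ?_
    obtain ⟨l, hlk, hxl⟩ := exists_mem_lgAlloc hx
    simp only [mem_iUnion]
    exact ⟨l, (measure_mono (lgAlloc_subset l)).trans (hlk.trans hk), hxl⟩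
  · exact subset_iUnion₂ (s := fun k (_ : volume (lgAlloc S k) ≤ a) ↦ lgAlloc S k) j le_rfl

end LengthGame

theorem PWUniform.measurableSet {P : Set ℝ} (hP : PWUniform P) : MeasurableSet P := by
  obtain ⟨⟨m, a, b, rfl⟩, -⟩ := hP
  exact .iUnion fun _ ↦ measurableSet_Icc

/-- All well behaved equilibria of the Length Game are utilitarian equivalent: every agent
derives the same utility from any two such equilibria. -/
theorem length_game_equilibria_utilitarian_equivalent {n : ℕ}
    (P : Fin n → Set ℝ) (hP : ∀ i, PWUniform (P i))
    (S S' : Fin n → Set ℝ)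
    (hS : ∀ i, IsStrategy (S i)) (hS' : ∀ i, IsStrategy (S' i))
    (hwb : ∀ i, S i ⊆ P i) (hwb' : ∀ i, S' i ⊆ P i)
    (heq : lgEquilibrium P S) (heq' : lgEquilibrium P S') :
    ∀ i, pwUtil (P i) (lgAlloc S i) = pwUtil (P i) (lgAlloc S' i) := by
  have hP₁ : ∀ i, P i ⊆ Icc 0 1 := fun i ↦ (hP i).2.1
  have hPm : ∀ i, MeasurableSet (P i) := fun i ↦ (hP i).measurableSet
  set μ : Measure ℝ := volume.restrict (Icc 0 1)
  have hμ : ∀ {i X}, X ⊆ P i → μ X = volume X := fun {i X} h ↦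
    Measure.restrict_eq_self _ (h.trans (hP₁ i))
  have hcov : ∀ {S : Fin n → Set ℝ}, (∀ i, IsStrategy (S i)) → (∀ i, S i ⊆ P i) →
      lgEquilibrium P S → ∀ i,
        μ (P i \ ⋃ (j) (_ : μ.real (lgAlloc S j) ≤ μ.real (lgAlloc S i)), lgAlloc S j) = 0 := by
    intro S hS hwb heq i
    have hA : ∀ j, μ (lgAlloc S j) = volume (lgAlloc S j) := fun j ↦
      hμ ((lgAlloc_subset j).trans (hwb j))
    have hreal : ∀ j, μ.real (lgAlloc S j) ≤ μ.real (lgAlloc S i) ↔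
        volume (lgAlloc S j) ≤ volume (lgAlloc S i) := fun j ↦ by
      rw [← hA, ← hA]
      exact ENNReal.toReal_le_toReal (measure_ne_top _ _) (measure_ne_top _ _)
    simp only [hreal, hμ sdiff_subset]
    exact heq.volume_diff_iUnion_lgAlloc hP₁ hPm (fun j ↦ (hS j).1) hwb i
  intro i
  have hsub : ∀ j, lgAlloc S j ⊆ P j := fun j ↦ (lgAlloc_subset j).trans (hwb j)
  have hsub' : ∀ j, lgAlloc S' j ⊆ P j := fun j ↦ (lgAlloc_subset j).trans (hwb' j)
  have h := measureReal_eq_of_cover (μ := μ) (measurableSet_lgAlloc fun j ↦ (hS j).1)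
    (measurableSet_lgAlloc fun j ↦ (hS' j).1) pairwise_disjoint_lgAlloc pairwise_disjoint_lgAlloc
    hsub hsub' (hcov hS hwb heq) (hcov hS' hwb' heq') i
  rw [measureReal_def, measureReal_def, hμ (hsub i), hμ (hsub' i)] at h
  unfold pwUtil
  rw [inter_eq_left.2 (hsub i), inter_eq_left.2 (hsub' i), h]
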